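/- Let 1/2 ≤ a ≤ 1 and let σ₁, σ₂ be real numbers with 0 < σ₁ < 1, σ₂ > 1 and 1 < σ₁ + σ₂ < 2. Then ∫_0^∞ ∫_0^∞ (y^{σ₂-1}/(e^y − 1)) H(a,x+y) x^{σ₁-1} dx dy + ∫_0^∞ ∫_0^∞ (x^{σ₁-1}/(x+y)) H(1,y) y^{σ₂-1} dx dy < 0, where both double integrals converge absolutely. -/

import Mathlib

open Set

/-- `H(a,x) = e^((1-a)x)/(e^x - 1) - 1/x`. -/
noncomputable def Hfun (a x : ℝ) : ℝ :=
  Real.exp ((1 - a) * x) / (Real.exp x - 1) - 1 / x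

open MeasureTheory

lemma mul_exp_half_lt_exp_sub_one {x : ℝ} (hx : 0 < x) :
    x * Real.exp (x / 2) < Real.exp x - 1 := by
  have h := Real.self_lt_sinh_iff.2 (half_pos hx)
  rw [Real.sinh_eq] at h
  have he : Real.exp (x / 2) * Real.exp (x / 2) = Real.exp x := by
    rw [← Real.exp_add, add_halves]
  have he' : Real.exp (-(x / 2)) * Real.exp (x / 2) = 1 := by
    rw [← Real.exp_add, neg_add_cancel, Real.exp_zero]
  nlinarith [Real.exp_pos (x / 2)]

lemma exp_sub_one_pos {x : ℝ} (hx : 0 < x) : 0 < Real.exp x - 1 :=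
  sub_pos.2 (Real.one_lt_exp_iff.2 hx)

lemma Hfun_neg {a x : ℝ} (ha : 1 / 2 ≤ a) (hx : 0 < x) : Hfun a x < 0 := by
  have h1 := mul_exp_half_lt_exp_sub_one hx
  have h2 : Real.exp ((1 - a) * x) ≤ Real.exp (x / 2) := Real.exp_le_exp.2 (by nlinarith)
  rw [Hfun, sub_neg, div_lt_div_iff₀ (exp_sub_one_pos hx) hx]
  nlinarith

lemma abs_Hfun_le {a x : ℝ} (ha : 1 / 2 ≤ a) (ha' : a ≤ 1) (hx : 0 < x) :
    |Hfun a x| ≤ 2 / (1 + x) := by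
  have hE := exp_sub_one_pos hx
  have h1 : 1 ≤ Real.exp ((1 - a) * x) := Real.one_le_exp (by nlinarith)
  have h2 : -Hfun a x ≤ 1 / x := by
    have : 0 < Real.exp ((1 - a) * x) / (Real.exp x - 1) := by positivity
    rw [Hfun]
    linarith
  have h3 : -Hfun a x ≤ 1 := by
    have h4 : 1 / x ≤ 1 + 1 / (Real.exp x - 1) := by
      have h5 : Real.exp (-x) * Real.exp x = 1 := by
        rw [← Real.exp_add, neg_add_cancel, Real.exp_zero]
      have h6 := Real.add_one_le_exp (-x)
      rw [← sub_nonneg]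
      have h7 : 1 + 1 / (Real.exp x - 1) - 1 / x
          = (x * Real.exp x - (Real.exp x - 1)) / ((Real.exp x - 1) * x) := by
        field_simp
        ring
      rw [h7]
      have h8 : 0 ≤ x * Real.exp x - (Real.exp x - 1) := by nlinarith [Real.exp_pos x]
      positivity
    have h5 : 1 / (Real.exp x - 1) ≤ Real.exp ((1 - a) * x) / (Real.exp x - 1) := by gcongr
    rw [Hfun]
    linarith
  rw [abs_of_neg (Hfun_neg ha hx), le_div_iff₀ (by positivity)]
  rw [le_div_iff₀ hx] at h2
  linarith

lemma measurable_Hfun (a : ℝ) : Measurable (Hfun a) := by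
  unfold Hfun
  fun_prop

lemma integrableOn_rpow_div_one_add {s : ℝ} (hs : 0 < s) (hs' : s < 1) :
    IntegrableOn (fun x : ℝ => x ^ (s - 1) / (1 + x)) (Ioi 0) := by
  have hm : Measurable fun x : ℝ => x ^ (s - 1) / (1 + x) := by fun_prop
  rw [← Ioc_union_Ioi_eq_Ioi zero_le_one]
  refine IntegrableOn.union ?_ ?_
  · have h : IntegrableOn (fun x : ℝ => x ^ (s - 1)) (Ioc 0 1) :=
      (intervalIntegrable_iff_integrableOn_Ioc_of_le zero_le_one).1
        (intervalIntegral.intervalIntegrable_rpow' (by linarith))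
    refine Integrable.mono' h hm.aestronglyMeasurable ?_
    filter_upwards [ae_restrict_mem measurableSet_Ioc] with x hx
    have hx0 := hx.1
    rw [Real.norm_of_nonneg (by positivity)]
    exact div_le_self (by positivity) (by linarith)
  · have h : IntegrableOn (fun x : ℝ => x ^ (s - 2)) (Ioi 1) :=
      integrableOn_Ioi_rpow_of_lt (by linarith) one_pos
    refine Integrable.mono' h hm.aestronglyMeasurable ?_
    filter_upwards [ae_restrict_mem measurableSet_Ioi] with x hx
    have hx0 : 0 < x := one_pos.trans hx
    rw [Real.norm_of_nonneg (by positivity), show s - 2 = s - 1 - 1 by ring,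
      Real.rpow_sub_one hx0.ne' (s - 1)]
    gcongr
    linarith

lemma integrableOn_rpow_div_exp_sub_one {s : ℝ} (hs : 1 < s) :
    IntegrableOn (fun y : ℝ => y ^ (s - 1) / (Real.exp y - 1)) (Ioi 0) := by
  have h := integrableOn_rpow_mul_exp_neg_mul_rpow (p := 1) (s := s - 2) (b := 1 / 2)
    (by linarith) one_pos (by norm_num)
  refine Integrable.mono' h (Measurable.aestronglyMeasurable (by fun_prop)) ?_
  filter_upwards [ae_restrict_mem measurableSet_Ioi] with y hy
  have hy : 0 < y := hy
  have hE := exp_sub_one_pos hy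
  rw [Real.norm_of_nonneg (by positivity), div_le_iff₀ hE, Real.rpow_one,
    show s - 2 = s - 1 - 1 by ring, Real.rpow_sub_one hy.ne' (s - 1)]
  have h1 : Real.exp (-(1 / 2) * y) * Real.exp (y / 2) = 1 := by
    rw [← Real.exp_add]
    ring_nf
    exact Real.exp_zero
  calc y ^ (s - 1) = y ^ (s - 1) / y * Real.exp (-(1 / 2) * y) * (y * Real.exp (y / 2)) := by
        rw [mul_mul_mul_comm, div_mul_cancel₀ _ hy.ne', h1, mul_one]
    _ ≤ _ := by
        gcongr
        exact (mul_exp_half_lt_exp_sub_one hy).le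

lemma rpow_div_add_eq {s x y : ℝ} (hx : 0 < x) (hy : 0 < y) :
    x ^ (s - 1) / (x + y) = y ^ (s - 2) * ((y⁻¹ * x) ^ (s - 1) / (1 + y⁻¹ * x)) := by
  rw [Real.mul_rpow (by positivity) hx.le, Real.inv_rpow hy.le,
    show s - 2 = s - 1 - 1 by ring, Real.rpow_sub_one hy.ne' (s - 1)]
  field_simp
  ring

lemma integrableOn_rpow_div_add {s y : ℝ} (hs : 0 < s) (hs' : s < 1) (hy : 0 < y) :
    IntegrableOn (fun x : ℝ => x ^ (s - 1) / (x + y)) (Ioi 0) := by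
  have h := (integrableOn_Ioi_comp_mul_left_iff
    (fun x : ℝ => x ^ (s - 1) / (1 + x)) 0 (inv_pos.2 hy)).2
    (by simpa using integrableOn_rpow_div_one_add hs hs')
  exact IntegrableOn.congr_fun (h.const_mul (y ^ (s - 2)))
    (fun x hx => (rpow_div_add_eq hx hy).symm) measurableSet_Ioi

lemma integral_rpow_div_add {s y : ℝ} (hy : 0 < y) :
    ∫ x in Ioi (0 : ℝ), x ^ (s - 1) / (x + y)
      = y ^ (s - 1) * ∫ x in Ioi (0 : ℝ), x ^ (s - 1) / (1 + x) := by
  rw [setIntegral_congr_fun measurableSet_Ioi (fun x hx => rpow_div_add_eq (s := s) hx hy),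
    integral_const_mul,
    integral_comp_mul_left_Ioi (fun x : ℝ => x ^ (s - 1) / (1 + x)) 0 (inv_pos.2 hy),
    mul_zero, inv_inv, smul_eq_mul, ← mul_assoc, show s - 2 = s - 1 - 1 by ring,
    Real.rpow_sub_one hy.ne' (s - 1), div_mul_cancel₀ _ hy.ne']

lemma integrableOn_exp_kernel {a σ₁ σ₂ : ℝ} (ha : 1 / 2 ≤ a) (ha' : a ≤ 1)
    (h1 : 0 < σ₁) (h1' : σ₁ < 1) (h2 : 1 < σ₂) :
    IntegrableOn
      (fun p : ℝ × ℝ =>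
        p.2 ^ (σ₂ - 1) / (Real.exp p.2 - 1) * Hfun a (p.1 + p.2) * p.1 ^ (σ₁ - 1))
      (Ioi (0 : ℝ) ×ˢ Ioi (0 : ℝ)) := by
  have hH := measurable_Hfun a
  have h := (Integrable.mul_prod (integrableOn_rpow_div_one_add h1 h1')
    (integrableOn_rpow_div_exp_sub_one h2)).const_mul 2
  rw [Measure.prod_restrict] at h
  refine Integrable.mono' h (by fun_prop) ?_
  filter_upwards [ae_restrict_mem (measurableSet_Ioi.prod measurableSet_Ioi)] with p hp
  have hx : 0 < p.1 := hp.1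
  have hy : 0 < p.2 := hp.2
  have hE := exp_sub_one_pos hy
  rw [norm_mul, norm_mul, Real.norm_of_nonneg (by positivity : 0 ≤ p.1 ^ (σ₁ - 1)),
    Real.norm_of_nonneg (by positivity : 0 ≤ p.2 ^ (σ₂ - 1) / (Real.exp p.2 - 1)),
    Real.norm_eq_abs]
  have hb : |Hfun a (p.1 + p.2)| ≤ 2 / (1 + p.1) :=
    (abs_Hfun_le ha ha' (add_pos hx hy)).trans (by gcongr; linarith)
  calc _ ≤ p.2 ^ (σ₂ - 1) / (Real.exp p.2 - 1) * (2 / (1 + p.1)) * p.1 ^ (σ₁ - 1) := by gcongr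
    _ = _ := by ring

lemma integrableOn_add_kernel {σ₁ σ₂ : ℝ} (h1 : 0 < σ₁) (h1' : σ₁ < 1)
    (h12 : 1 < σ₁ + σ₂) (h12' : σ₁ + σ₂ < 2) :
    IntegrableOn
      (fun p : ℝ × ℝ => p.1 ^ (σ₁ - 1) / (p.1 + p.2) * Hfun 1 p.2 * p.2 ^ (σ₂ - 1))
      (Ioi (0 : ℝ) ×ˢ Ioi (0 : ℝ)) := by
  have hH := measurable_Hfun 1
  rw [IntegrableOn, Measure.volume_eq_prod, ← Measure.prod_restrict,
    integrable_prod_iff' (by fun_prop)]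
  constructor
  · filter_upwards [ae_restrict_mem measurableSet_Ioi] with y hy
    exact ((integrableOn_rpow_div_add h1 h1' hy).mul_const _).mul_const _
  · set K := ∫ x in Ioi (0 : ℝ), x ^ (σ₁ - 1) / (1 + x) with hK
    have hK0 : 0 ≤ K := setIntegral_nonneg measurableSet_Ioi fun x hx => by
      have hx : 0 < x := hx
      positivity
    have h := (integrableOn_rpow_div_one_add (s := σ₁ + σ₂ - 1) (by linarith)
      (by linarith)).const_mul (2 * K)
    have he : EqOn (fun y : ℝ => y ^ (σ₁ - 1) * K * |Hfun 1 y| * y ^ (σ₂ - 1))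
        (fun y => ∫ x in Ioi (0 : ℝ),
          ‖x ^ (σ₁ - 1) / (x + y) * Hfun 1 y * y ^ (σ₂ - 1)‖) (Ioi 0) := by
      intro y hy
      have hy : 0 < y := hy
      have hn : EqOn (fun x : ℝ => ‖x ^ (σ₁ - 1) / (x + y) * Hfun 1 y * y ^ (σ₂ - 1)‖)
          (fun x => x ^ (σ₁ - 1) / (x + y) * |Hfun 1 y| * y ^ (σ₂ - 1)) (Ioi 0) := by
        intro x hx
        have hx : 0 < x := hx
        simp only [norm_mul]
        rw [Real.norm_of_nonneg (by positivity : 0 ≤ x ^ (σ₁ - 1) / (x + y)),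
          Real.norm_of_nonneg (by positivity : 0 ≤ y ^ (σ₂ - 1)), Real.norm_eq_abs]
      simp only
      rw [setIntegral_congr_fun measurableSet_Ioi hn, integral_mul_const, integral_mul_const,
        integral_rpow_div_add hy]
    refine IntegrableOn.congr_fun ?_ he measurableSet_Ioi
    refine Integrable.mono' h (Measurable.aestronglyMeasurable (by fun_prop)) ?_
    filter_upwards [ae_restrict_mem measurableSet_Ioi] with y hy
    have hy : 0 < y := hy
    rw [Real.norm_of_nonneg (by positivity)]
    calc _ ≤ y ^ (σ₁ - 1) * K * (2 / (1 + y)) * y ^ (σ₂ - 1) := by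
          gcongr
          exact abs_Hfun_le (by norm_num) le_rfl hy
      _ = 2 * K * (y ^ (σ₁ - 1) * y ^ (σ₂ - 1) / (1 + y)) := by ring
      _ = _ := by
          rw [← Real.rpow_add hy]
          ring_nf

lemma setIntegral_neg_of_forall_neg {α : Type*} [MeasurableSpace α] {μ : Measure α} {s : Set α}
    {f : α → ℝ} (hs : MeasurableSet s) (hμ : μ s ≠ 0) (hf : IntegrableOn f s μ)
    (h : ∀ x ∈ s, f x < 0) : ∫ x in s, f x ∂μ < 0 := by
  rw [← neg_pos, ← integral_neg]
  refine (setIntegral_pos_iff_support_of_nonneg_ae (f := -f) ?_ hf.neg).2 ?_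
  · filter_upwards [ae_restrict_mem hs] with x hx
    simpa using (h x hx).le
  · refine (pos_iff_ne_zero.2 hμ).trans_le (measure_mono fun x hx => ⟨?_, hx⟩)
    simpa using (h x hx).ne

theorem doubleZeta_integral_neg (a : ℝ) (ha : 1 / 2 ≤ a) (ha' : a ≤ 1)
    (σ₁ σ₂ : ℝ) (h1 : 0 < σ₁) (h1' : σ₁ < 1) (h2 : 1 < σ₂)
    (h12 : 1 < σ₁ + σ₂) (h12' : σ₁ + σ₂ < 2) :
    MeasureTheory.IntegrableOn
      (fun p : ℝ × ℝ =>
        p.2 ^ (σ₂ - 1) / (Real.exp p.2 - 1) * Hfun a (p.1 + p.2) * p.1 ^ (σ₁ - 1))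
      (Ioi (0 : ℝ) ×ˢ Ioi (0 : ℝ)) ∧
    MeasureTheory.IntegrableOn
      (fun p : ℝ × ℝ =>
        p.1 ^ (σ₁ - 1) / (p.1 + p.2) * Hfun 1 p.2 * p.2 ^ (σ₂ - 1))
      (Ioi (0 : ℝ) ×ˢ Ioi (0 : ℝ)) ∧
    (∫ y in Ioi (0 : ℝ), ∫ x in Ioi (0 : ℝ),
        y ^ (σ₂ - 1) / (Real.exp y - 1) * Hfun a (x + y) * x ^ (σ₁ - 1)) +
      (∫ y in Ioi (0 : ℝ), ∫ x in Ioi (0 : ℝ),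
        x ^ (σ₁ - 1) / (x + y) * Hfun 1 y * y ^ (σ₂ - 1)) < 0 := by
  have hI := integrableOn_exp_kernel ha ha' h1 h1' h2
  refine ⟨hI, integrableOn_add_kernel h1 h1' h12 h12', add_neg_of_neg_of_nonpos ?_ ?_⟩
  · have hneg := setIntegral_neg_of_forall_neg (measurableSet_Ioi.prod measurableSet_Ioi)
      (by simp [Measure.volume_eq_prod]) hI (fun p hp => by
        have hx : 0 < p.1 := hp.1
        have hy : 0 < p.2 := hp.2
        have hE := exp_sub_one_pos hy
        exact mul_neg_of_neg_of_pos
          (mul_neg_of_pos_of_neg (by positivity) (Hfun_neg ha (add_pos hx hy))) (by positivity))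
    rw [IntegrableOn, Measure.volume_eq_prod, ← Measure.prod_restrict] at hI
    rwa [Measure.volume_eq_prod, ← Measure.prod_restrict, integral_prod_symm _ hI] at hneg
  · refine setIntegral_nonpos measurableSet_Ioi fun y hy =>
      setIntegral_nonpos measurableSet_Ioi fun x hx => ?_
    have hx : 0 < x := hx
    have hy : 0 < y := hy
    exact mul_nonpos_of_nonpos_of_nonneg
      (mul_nonpos_of_nonneg_of_nonpos (by positivity) (Hfun_neg (by norm_num) hy).le)
      (by positivity)
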